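/- Neighborhood area bound: Let r > 0, 0 < η < 1, and let γ be a connected compact subset of the sphere S(0,r) ⊂ R^3 whose 1-dimensional Hausdorff measure is l. Then there exist universal constants C1, C2 > 0 (independent of γ, r and η) such that the 2-dimensional Hausdorff measure of { x ∈ S(0,r) : d(x, γ) ≤ η } is at most η (C1 l + C2 η). -/

import Mathlib

open scoped MeasureTheory NNReal ENNReal

/-- Hausdorff measure bound under a map that is antilipschitz on a set. -/
lemma hausdorff_le_of_antilip_on {X Y : Type*} [MetricSpace X] [MeasurableSpace X] [BorelSpace X]
    [MetricSpace Y] [MeasurableSpace Y] [BorelSpace Y] [Nonempty X] (f : X → Y) (s : Set X)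
    (K : ℝ≥0) (d : ℝ) (hd : 0 ≤ d)
    (h : ∀ x ∈ s, ∀ y ∈ s, dist x y ≤ K * dist (f x) (f y)) :
    μH[d] s ≤ (K : ℝ≥0∞) ^ d * μH[d] (f '' s) := by
  have hinj : Set.InjOn f s := by
    intro x hx y hy hxy
    have := h x hx y hy
    rw [hxy, dist_self, mul_zero] at this
    exact dist_le_zero.1 this
  have hl : LipschitzOnWith K (Function.invFunOn f s) (f '' s) := by
    apply LipschitzOnWith.of_dist_le_mul
    rintro _ ⟨x, hx, rfl⟩ _ ⟨y, hy, rfl⟩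
    rw [hinj.leftInvOn_invFunOn hx, hinj.leftInvOn_invFunOn hy]
    exact h x hx y hy
  have := hl.hausdorffMeasure_image_le hd
  rwa [hinj.leftInvOn_invFunOn.image_image] at this

lemma coord_dist_aux (c : ℝ) (a b a' b' z z' : ℝ)
    (h : a ^ 2 + b ^ 2 + z ^ 2 = c) (h' : a' ^ 2 + b' ^ 2 + z' ^ 2 = c)
    (ha : |a| ≤ z) (hb : |b| ≤ z) (ha' : |a'| ≤ z') (hb' : |b'| ≤ z') :
    |z - z'| ≤ |a - a'| + |b - b'| := by
  have hz : 0 ≤ z := (abs_nonneg _).trans ha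
  have hz' : 0 ≤ z' := (abs_nonneg _).trans ha'
  rcases (add_nonneg hz hz').eq_or_lt with h0 | h0
  · have h1 : z = 0 := by linarith
    have h2 : z' = 0 := by linarith
    rw [h1, h2]; simp; positivity
  · have e : (z - z') * (z + z') = (a' - a) * (a + a') + (b' - b) * (b + b') := by linarith
    have e2 : |z - z'| * (z + z') ≤ (|a - a'| + |b - b'|) * (z + z') := by
      calc |z - z'| * (z + z') = |(z - z') * (z + z')| := by rw [abs_mul, abs_of_pos h0]
        _ = |(a' - a) * (a + a') + (b' - b) * (b + b')| := by rw [e]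
        _ ≤ |a' - a| * |a + a'| + |b' - b| * |b + b'| := by
            rw [← abs_mul, ← abs_mul]; exact abs_add_le _ _
        _ ≤ |a' - a| * (z + z') + |b' - b| * (z + z') := by
            gcongr
            · exact (abs_add_le _ _).trans (add_le_add ha ha')
            · exact (abs_add_le _ _).trans (add_le_add hb hb')
        _ = _ := by rw [abs_sub_comm a', abs_sub_comm b']; ring
    exact le_of_mul_le_mul_right e2 h0

lemma piece_bound (i j k : Fin 3) (s : ℝ) (hs : s ^ 2 = 1)
    (hn : ∀ x : EuclideanSpace ℝ (Fin 3), ‖x‖ ^ 2 = x j ^ 2 + x k ^ 2 + x i ^ 2)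
    (p : EuclideanSpace ℝ (Fin 3)) (r ρ : ℝ) (hρ : 0 < ρ) :
    μH[2] {x ∈ Metric.sphere (0 : EuclideanSpace ℝ (Fin 3)) r ∩ Metric.closedBall p ρ |
      |x j| ≤ s * x i ∧ |x k| ≤ s * x i} ≤ ENNReal.ofReal (36 * ρ ^ 2) := by
  set S := {x ∈ Metric.sphere (0 : EuclideanSpace ℝ (Fin 3)) r ∩ Metric.closedBall p ρ |
      |x j| ≤ s * x i ∧ |x k| ≤ s * x i} with hS
  let f : EuclideanSpace ℝ (Fin 3) → ℝ × ℝ := fun x => (x j, x k)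
  have h1 : μH[2] S ≤ ((3 : ℝ≥0) : ℝ≥0∞) ^ (2 : ℝ) * μH[2] (f '' S) := by
    apply hausdorff_le_of_antilip_on f S 3 2 (by norm_num)
    rintro x ⟨⟨hx, -⟩, hx1, hx2⟩ y ⟨⟨hy, -⟩, hy1, hy2⟩
    rw [mem_sphere_zero_iff_norm] at hx hy
    have ex := hn x
    have ey := hn y
    rw [hx] at ex
    rw [hy] at ey
    have key := coord_dist_aux (r ^ 2) (x j) (x k) (y j) (y k) (s * x i) (s * y i)
      (by rw [mul_pow, hs]; linarith) (by rw [mul_pow, hs]; linarith) hx1 hx2 hy1 hy2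
    have d1 : |x j - y j| ≤ dist (f x) (f y) := by
      rw [← Real.dist_eq]; exact le_max_left _ _
    have d2 : |x k - y k| ≤ dist (f x) (f y) := by
      rw [← Real.dist_eq]; exact le_max_right _ _
    have hxy := hn (x - y)
    simp only [PiLp.sub_apply] at hxy
    rw [dist_eq_norm]
    set D := dist (f x) (f y)
    have hD : 0 ≤ D := dist_nonneg
    have k1 : (s * x i - s * y i) ^ 2 ≤ (2 * D) ^ 2 := by
      rw [← sq_abs]; gcongr; linarith
    have k2 : (x i - y i) ^ 2 = (s * x i - s * y i) ^ 2 := by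
      rw [← mul_sub, mul_pow, hs, one_mul]
    have k3 : (x j - y j) ^ 2 ≤ D ^ 2 := by rw [← sq_abs]; gcongr
    have k4 : (x k - y k) ^ 2 ≤ D ^ 2 := by rw [← sq_abs]; gcongr
    push_cast
    refine (sq_le_sq₀ (norm_nonneg _) (by positivity)).1 ?_
    nlinarith
  have h2 : μH[2] (f '' S) ≤ ENNReal.ofReal (4 * ρ ^ 2) := by
    rw [MeasureTheory.hausdorffMeasure_prod_real]
    have sub : f '' S ⊆ Metric.closedBall (p j) ρ ×ˢ Metric.closedBall (p k) ρ := by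
      rintro _ ⟨x, ⟨⟨-, hx⟩, -⟩, rfl⟩
      rw [mem_closedBall_iff_norm] at hx
      have a1 := PiLp.norm_apply_le (x - p) j
      have a2 := PiLp.norm_apply_le (x - p) k
      simp only [PiLp.sub_apply] at a1 a2
      exact ⟨mem_closedBall_iff_norm.2 (a1.trans hx), mem_closedBall_iff_norm.2 (a2.trans hx)⟩
    refine (MeasureTheory.measure_mono sub).trans ?_
    rw [MeasureTheory.Measure.volume_eq_prod, MeasureTheory.Measure.prod_prod,
      Real.volume_closedBall, Real.volume_closedBall, ← ENNReal.ofReal_mul (by positivity)]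
    apply ENNReal.ofReal_le_ofReal; nlinarith
  refine h1.trans ((mul_le_mul_right h2 _).trans ?_)
  have : ((3 : ℝ≥0) : ℝ≥0∞) ^ (2 : ℝ) = ENNReal.ofReal 9 := by
    rw [ENNReal.rpow_ofNat]; norm_num
  rw [this, ← ENNReal.ofReal_mul (by norm_num)]
  apply ENNReal.ofReal_le_ofReal; nlinarith

lemma cap_bound (p : EuclideanSpace ℝ (Fin 3)) (r ρ : ℝ) (hρ : 0 < ρ) :
    μH[2] (Metric.sphere (0 : EuclideanSpace ℝ (Fin 3)) r ∩ Metric.closedBall p ρ)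
      ≤ ENNReal.ofReal (216 * ρ ^ 2) := by
  let S : Fin 3 → Fin 3 → Fin 3 → ℝ → Set (EuclideanSpace ℝ (Fin 3)) := fun i j k s =>
    {x ∈ Metric.sphere (0 : EuclideanSpace ℝ (Fin 3)) r ∩ Metric.closedBall p ρ |
      |x j| ≤ s * x i ∧ |x k| ≤ s * x i}
  have hsub : Metric.sphere (0 : EuclideanSpace ℝ (Fin 3)) r ∩ Metric.closedBall p ρ ⊆
      (S 0 1 2 1 ∪ S 0 1 2 (-1)) ∪ (S 1 0 2 1 ∪ S 1 0 2 (-1)) ∪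
        (S 2 0 1 1 ∪ S 2 0 1 (-1)) := by
    intro x hx
    simp only [S, Set.mem_union, Set.mem_setOf_eq, hx, true_and, one_mul, neg_mul]
    rcases abs_cases (x 0) with h0 | h0 <;> rcases abs_cases (x 1) with h1 | h1 <;>
    rcases abs_cases (x 2) with h2 | h2 <;>
    rcases le_total |x 0| |x 1| with a | a <;> rcases le_total |x 0| |x 2| with b | b <;>
    rcases le_total |x 1| |x 2| with c | c <;> grind
  have e1 : ∀ x : EuclideanSpace ℝ (Fin 3), ‖x‖ ^ 2 = x 1 ^ 2 + x 2 ^ 2 + x 0 ^ 2 := by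
    intro x; rw [EuclideanSpace.real_norm_sq_eq, Fin.sum_univ_three]; ring
  have e2 : ∀ x : EuclideanSpace ℝ (Fin 3), ‖x‖ ^ 2 = x 0 ^ 2 + x 2 ^ 2 + x 1 ^ 2 := by
    intro x; rw [e1]; ring
  have e3 : ∀ x : EuclideanSpace ℝ (Fin 3), ‖x‖ ^ 2 = x 0 ^ 2 + x 1 ^ 2 + x 2 ^ 2 := by
    intro x; rw [e1]; ring
  have s1 : (1 : ℝ) ^ 2 = 1 := by norm_num
  have s2 : (-1 : ℝ) ^ 2 = 1 := by norm_num
  have hU : ∀ A B : Set (EuclideanSpace ℝ (Fin 3)), ∀ a b : ℝ, 0 ≤ a → 0 ≤ b →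
      μH[2] A ≤ ENNReal.ofReal a → μH[2] B ≤ ENNReal.ofReal b →
      μH[2] (A ∪ B) ≤ ENNReal.ofReal (a + b) := by
    intro A B a b ha hb hA hB
    rw [ENNReal.ofReal_add ha hb]
    exact (MeasureTheory.measure_union_le _ _).trans (add_le_add hA hB)
  refine (MeasureTheory.measure_mono hsub).trans ((hU _ _ _ _ ?_ ?_
    (hU _ _ _ _ ?_ ?_
    (hU _ _ _ _ ?_ ?_ (piece_bound 0 1 2 1 s1 e1 p r ρ hρ) (piece_bound 0 1 2 (-1) s2 e1 p r ρ hρ))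
    (hU _ _ _ _ ?_ ?_ (piece_bound 1 0 2 1 s1 e2 p r ρ hρ) (piece_bound 1 0 2 (-1) s2 e2 p r ρ hρ)))
    (hU _ _ _ _ ?_ ?_ (piece_bound 2 0 1 1 s1 e3 p r ρ hρ)
      (piece_bound 2 0 1 (-1) s2 e3 p r ρ hρ))).trans ?_)
  all_goals first | positivity | skip
  apply ENNReal.ofReal_le_ofReal; nlinarith

lemma length_bound {X : Type*} [MetricSpace X] [MeasurableSpace X] [BorelSpace X]
    (γ : Set X) (hγ : IsPreconnected γ) (p q : X) (hp : p ∈ γ) (hq : q ∈ γ) (η : ℝ)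
    (hη : 0 < η) (hpq : η ≤ dist q p) :
    ENNReal.ofReal η ≤ μH[1] (γ ∩ Metric.ball p η) := by
  have hl : LipschitzWith 1 (fun x => dist x p) := LipschitzWith.dist_left p
  have h1 := hl.hausdorffMeasure_image_le (d := 1) (by norm_num) (γ ∩ Metric.ball p η)
  rw [MeasureTheory.hausdorffMeasure_real] at h1
  have hsub : Set.Ico 0 η ⊆ (fun x => dist x p) '' (γ ∩ Metric.ball p η) := by
    intro t ht
    have := hγ.intermediate_value hp hq (f := fun x => dist x p) hl.continuous.continuousOn
    obtain ⟨x, hx, hxt⟩ := this (show t ∈ Set.Icc (dist p p) (dist q p) from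
      ⟨by simpa using ht.1, ht.2.le.trans hpq⟩)
    refine ⟨x, ⟨hx, ?_⟩, hxt⟩
    rw [Metric.mem_ball]
    exact lt_of_eq_of_lt hxt ht.2
  have h2 := (MeasureTheory.measure_mono (μ := MeasureTheory.volume) hsub).trans h1
  simpa using h2

/-- Neighborhood area bound: there are universal constants `C1, C2 > 0` such that for
every `r > 0`, `0 < η < 1`, and every connected compact subset `γ` of the sphere
`S(0,r) ⊂ ℝ³` of `1`-dimensional Hausdorff measure `l`, the `2`-dimensional Hausdorff
measure of the `η`-neighborhood `{x ∈ S(0,r) : d(x,γ) ≤ η}` is at most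
`η (C1 l + C2 η)`. -/
theorem sphere_neighborhood_area_bound :
    ∃ C1 C2 : ℝ, 0 < C1 ∧ 0 < C2 ∧
      ∀ (r η : ℝ), 0 < r → η ∈ Set.Ioo (0 : ℝ) 1 →
        ∀ γ : Set (EuclideanSpace ℝ (Fin 3)),
          γ ⊆ Metric.sphere (0 : EuclideanSpace ℝ (Fin 3)) r →
          IsConnected γ → IsCompact γ →
          μH[2] {x ∈ Metric.sphere (0 : EuclideanSpace ℝ (Fin 3)) r |
              Metric.infDist x γ ≤ η}
            ≤ ENNReal.ofReal η *
                (ENNReal.ofReal C1 * μH[1] γ + ENNReal.ofReal C2 * ENNReal.ofReal η) := by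
  refine ⟨1944, 864, by norm_num, by norm_num, ?_⟩
  intro r η hr hη γ hγs hconn hcomp
  have hη0 : 0 < η := hη.1
  have near : ∀ x, Metric.infDist x γ ≤ η → ∃ y ∈ γ, dist x y ≤ η := by
    intro x hx
    obtain ⟨y, hy, hxy⟩ := hcomp.exists_infDist_eq_dist hconn.nonempty x
    exact ⟨y, hy, hxy ▸ hx⟩
  by_cases hsmall : ∃ p ∈ γ, ∀ q ∈ γ, dist q p < η
  · obtain ⟨p, hp, hpq⟩ := hsmall
    have hsub : {x ∈ Metric.sphere (0 : EuclideanSpace ℝ (Fin 3)) r | Metric.infDist x γ ≤ η} ⊆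
        Metric.sphere (0 : EuclideanSpace ℝ (Fin 3)) r ∩ Metric.closedBall p (2 * η) := by
      rintro x ⟨hx, hxd⟩
      obtain ⟨y, hy, hxy⟩ := near x hxd
      refine ⟨hx, ?_⟩
      rw [Metric.mem_closedBall]
      linarith [dist_triangle x y p, hpq y hy]
    refine (MeasureTheory.measure_mono hsub).trans
      ((cap_bound p r (2 * η) (by positivity)).trans ?_)
    rw [mul_add]
    refine le_trans (le_of_eq ?_) le_add_self
    rw [← ENNReal.ofReal_mul (by norm_num), ← ENNReal.ofReal_mul hη0.le]
    congr 1; ring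
  · push Not at hsmall
    lift η to ℝ≥0 using hη0.le
    have hη1 : η ≠ 0 := by rintro rfl; simp at hη0
    have hpk : Metric.packingNumber (2 * η) γ ≠ ⊤ := by
      obtain ⟨N, hN, hfin, hcov⟩ := Metric.exists_finite_isCover_of_isCompact hη1 hcomp
      refine ne_top_of_le_ne_top ?_ ((Metric.packingNumber_two_mul_le_externalCoveringNumber η γ).trans
        hcov.externalCoveringNumber_le_encard)
      exact Set.encard_ne_top_iff.2 hfin
    obtain ⟨P, hP⟩ : ∃ P, P = Metric.maximalSeparatedSet (2 * η) γ := ⟨_, rfl⟩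
    have hPfin : P.Finite := by
      rw [← Set.encard_ne_top_iff, hP, Metric.encard_maximalSeparatedSet hpk]; exact hpk
    have hPsub : P ⊆ γ := hP ▸ Metric.maximalSeparatedSet_subset
    have hPsep : Metric.IsSeparated ((2 * η : ℝ≥0) : ℝ≥0∞) P :=
      hP ▸ Metric.isSeparated_maximalSeparatedSet
    have hPcov : Metric.IsCover (2 * η) γ P := hP ▸ Metric.isCover_maximalSeparatedSet hpk
    clear hP
    rw [Metric.isCover_iff_subset_iUnion_closedBall] at hPcov
    lift P to Finset (EuclideanSpace ℝ (Fin 3)) using hPfin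
    have hlen : (P.card : ℝ≥0∞) * ENNReal.ofReal η ≤ μH[1] γ := by
      have hdisj : (P : Set (EuclideanSpace ℝ (Fin 3))).PairwiseDisjoint
          (fun p => γ ∩ Metric.ball p (η : ℝ)) := by
        intro p hp q hq hpq
        refine Disjoint.mono Set.inter_subset_right Set.inter_subset_right ?_
        apply Metric.ball_disjoint_ball
        have := hPsep hp hq hpq
        simp only [edist_nndist] at this
        have h' : (2 * η : ℝ≥0) < nndist p q := by exact_mod_cast this
        have h'' : (2 * (η : ℝ)) < dist p q := by exact_mod_cast h'
        linarith
      calc (P.card : ℝ≥0∞) * ENNReal.ofReal η = ∑ p ∈ P, ENNReal.ofReal η := by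
            rw [Finset.sum_const, nsmul_eq_mul]
        _ ≤ ∑ p ∈ P, μH[1] (γ ∩ Metric.ball p (η : ℝ)) := by
            apply Finset.sum_le_sum
            intro p hp
            obtain ⟨q, hq, hqp⟩ := hsmall p (hPsub hp)
            exact length_bound γ hconn.isPreconnected p q (hPsub hp) hq η hη0 hqp
        _ = μH[1] (⋃ p ∈ P, γ ∩ Metric.ball p (η : ℝ)) := by
            rw [MeasureTheory.measure_biUnion_finset hdisj]
            intro p hp
            exact hcomp.isClosed.measurableSet.inter Metric.isOpen_ball.measurableSet
        _ ≤ μH[1] γ := MeasureTheory.measure_mono (by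
            simp only [Set.iUnion_subset_iff]; intro p hp; exact Set.inter_subset_left)
    have hsub : {x ∈ Metric.sphere (0 : EuclideanSpace ℝ (Fin 3)) r |
        Metric.infDist x γ ≤ (η : ℝ)} ⊆
        ⋃ p ∈ P, Metric.sphere (0 : EuclideanSpace ℝ (Fin 3)) r ∩
          Metric.closedBall p (3 * (η : ℝ)) := by
      rintro x ⟨hx, hxd⟩
      obtain ⟨y, hy, hxy⟩ := near x hxd
      obtain ⟨p, hp, hyp⟩ := Set.mem_iUnion₂.1 (hPcov hy)
      refine Set.mem_iUnion₂.2 ⟨p, hp, hx, ?_⟩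
      rw [Metric.mem_closedBall] at hyp ⊢
      push_cast at hyp
      linarith [dist_triangle x y p]
    calc μH[2] {x ∈ Metric.sphere (0 : EuclideanSpace ℝ (Fin 3)) r |
        Metric.infDist x γ ≤ (η : ℝ)}
        ≤ ∑ p ∈ P, μH[2] (Metric.sphere (0 : EuclideanSpace ℝ (Fin 3)) r ∩
          Metric.closedBall p (3 * (η : ℝ))) :=
          (MeasureTheory.measure_mono hsub).trans (MeasureTheory.measure_biUnion_finset_le _ _)
      _ ≤ ∑ p ∈ P, ENNReal.ofReal (216 * (3 * (η : ℝ)) ^ 2) :=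
          Finset.sum_le_sum fun p _ => cap_bound p r _ (by positivity)
      _ = ENNReal.ofReal η * (ENNReal.ofReal 1944 * ((P.card : ℝ≥0∞) * ENNReal.ofReal η)) := by
          rw [Finset.sum_const, nsmul_eq_mul]
          have : 216 * (3 * (η : ℝ)) ^ 2 = η * (1944 * η) := by ring
          rw [this, ENNReal.ofReal_mul hη0.le, ENNReal.ofReal_mul (by norm_num)]
          ring
      _ ≤ ENNReal.ofReal η * (ENNReal.ofReal 1944 * μH[1] γ) := by gcongr
      _ ≤ _ := by gcongr; exact le_self_add
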